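/- arXiv:2105.07184 — 6 statements merged into one kernel-verified Lean document; each statement's English description precedes it below -/
import Mathlib

section
/- Let R be a commutative Noetherian ring and I an ideal of R. Then the following are equivalent: (a) I is a trace ideal of some finitely generated R-module; (b) I = tr_R(I); (c) the map Hom_R(I, I) → Hom_R(I, R) induced by post-composition with the inclusion I ⊆ R is bijective. -/
/-- The trace ideal of an `R`-module `M`: the sum of the images of all
`R`-linear maps `M → R`. -/
def traceIdeal (R : Type*) [CommRing R] (M : Type*) [AddCommGroup M] [Module R M] : Ideal R :=
  ⨆ f : M →ₗ[R] R, LinearMap.range f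

theorem apply_mem_traceIdeal {R M : Type*} [CommRing R] [AddCommGroup M] [Module R M]
    (f : M →ₗ[R] R) (m : M) : f m ∈ traceIdeal R M :=
  le_iSup (fun g : M →ₗ[R] R => LinearMap.range g) f ⟨m, rfl⟩

/-- An ideal is its own trace ideal iff it is stable under all linear maps `I → R`. -/
theorem eq_traceIdeal_self_iff {R : Type*} [CommRing R] (I : Ideal R) :
    I = traceIdeal R ↥I ↔ ∀ (f : ↥I →ₗ[R] R) (x : ↥I), f x ∈ I := by
  refine ⟨fun h f x => h.ge (apply_mem_traceIdeal f x), fun h => le_antisymm ?_ ?_⟩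
  · exact fun x hx => apply_mem_traceIdeal I.subtype ⟨x, hx⟩
  · refine iSup_le fun f => ?_
    rintro _ ⟨x, rfl⟩
    exact h f x

/-- The trace ideal of a module is stable under all linear maps from it to the ring. -/
theorem apply_mem_of_eq_traceIdeal {R M : Type*} [CommRing R] [AddCommGroup M] [Module R M]
    {I : Ideal R} (hI : I = traceIdeal R M) (f : ↥I →ₗ[R] R) (x : ↥I) : f x ∈ I := by
  have hle : traceIdeal R M ≤ (Submodule.comap f I).map I.subtype := by
    refine iSup_le fun g => ?_
    rintro _ ⟨m, rfl⟩
    have hg : ∀ m, g m ∈ I := fun m => hI.ge (apply_mem_traceIdeal g m)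
    exact ⟨⟨g m, hg m⟩, hI.ge (apply_mem_traceIdeal (f ∘ₗ g.codRestrict I hg) m), rfl⟩
  obtain ⟨y, hy, hyx⟩ := hle (hI.le x.2)
  obtain rfl : y = x := Subtype.ext hyx
  exact hy

/-- Let `R` be a commutative Noetherian ring and `I` an ideal of `R`. Then the following are
equivalent: (a) `I` is a trace ideal of some finitely generated `R`-module;
(b) `I = tr_R(I)`; (c) the map `Hom_R(I, I) → Hom_R(I, R)` induced by post-composition with
the inclusion `I ⊆ R` is bijective. -/
theorem trace_ideal_tfae {R : Type} [CommRing R] [IsNoetherianRing R] (I : Ideal R) :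
    ((∃ (M : Type) (_ : AddCommGroup M) (_ : Module R M),
        Module.Finite R M ∧ I = traceIdeal R M) ↔ I = traceIdeal R ↥I) ∧
    (I = traceIdeal R ↥I ↔
      Function.Bijective (fun f : (↥I →ₗ[R] ↥I) => I.subtype ∘ₗ f)) := by
  refine ⟨⟨?_, fun h => ⟨↥I, inferInstance, inferInstance, inferInstance, h⟩⟩, ?_⟩
  · rintro ⟨M, _, _, _, h⟩
    exact (eq_traceIdeal_self_iff I).2 (apply_mem_of_eq_traceIdeal h)
  · rw [eq_traceIdeal_self_iff]
    refine ⟨fun h => ⟨fun f g hfg => ?_, fun f => ⟨f.codRestrict I (h f), ?_⟩⟩, fun h f x => ?_⟩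
    · ext x
      exact LinearMap.congr_fun hfg x
    · ext x
      rfl
    · obtain ⟨g, rfl⟩ := h.2 f
      exact (g x).2
end

section
/- Let R be a commutative Noetherian ring and M a finitely generated R-module of positive rank. Then the trace ideal tr_R(M) contains a nonzerodivisor of R. -/
open scoped TensorProduct

/-- Let `R` be a commutative Noetherian ring and `M` a finitely generated `R`-module of
positive rank (i.e. `Q(R) ⊗_R M` is a free module of positive rank over the total ring of
fractions `Q(R)`). Then the trace ideal `tr_R(M)` contains a nonzerodivisor of `R`. -/
theorem traceIdeal_contains_nonZeroDivisor {R : Type} [CommRing R] [IsNoetherianRing R]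
    (M : Type) [AddCommGroup M] [Module R M] [Module.Finite R M]
    [Module.Free (FractionRing R) (FractionRing R ⊗[R] M)]
    (hrank : 0 < Module.rank (FractionRing R) (FractionRing R ⊗[R] M)) :
    ∃ x ∈ traceIdeal R M, x ∈ nonZeroDivisors R := by
  cases subsingleton_or_nontrivial R with
  | inl _ => exact ⟨0, zero_mem _, by rw [Subsingleton.elim (0 : R) 1]; exact one_mem _⟩
  | inr _ =>
    let b := Module.Free.chooseBasis (FractionRing R) (FractionRing R ⊗[R] M)
    have : Nontrivial (FractionRing R ⊗[R] M) := by
      by_contra h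
      rw [not_nontrivial_iff_subsingleton] at h
      exact hrank.ne' (rank_subsingleton' _ _)
    obtain ⟨i⟩ := b.index_nonempty
    let ι : M →ₗ[R] FractionRing R ⊗[R] M := TensorProduct.mk R (FractionRing R) M 1
    have := Module.finitePresentation_of_finite R M
    obtain ⟨φ, s, hφ⟩ := Module.FinitePresentation.exists_lift_of_isLocalizedModule
      (nonZeroDivisors R) (Algebra.linearMap R (FractionRing R))
      ((b.coord i).restrictScalars R ∘ₗ ι)
    obtain ⟨⟨m, t⟩, hm⟩ := IsLocalizedModule.surj (nonZeroDivisors R) ι (b i)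
    have hφm : φ m = s * t := by
      apply IsFractionRing.injective R (FractionRing R)
      have h := LinearMap.congr_fun hφ m
      simp only [LinearMap.comp_apply, LinearMap.smul_apply, ← hm, Submonoid.smul_def,
        LinearMap.map_smul, LinearMap.restrictScalars_apply, Module.Basis.coord_apply,
        Module.Basis.repr_self, Finsupp.single_eq_same, Algebra.linearMap_apply] at h
      rw [h, map_mul, Algebra.smul_def, Algebra.smul_def, mul_one]
    exact ⟨φ m, (le_iSup (fun f : M →ₗ[R] R => LinearMap.range f) φ) ⟨m, rfl⟩,
      hφm ▸ mul_mem s.2 t.2⟩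
end

section
/- Let R be a commutative Noetherian ring, M a finitely generated reflexive R-module of positive rank, and A = tr_R(M) : tr_R(M) ⊆ Q(R). Then any two A-module structures on M whose restriction along R → A is the given R-module structure coincide; that is, the A-module structure on M extending the R-action is unique. -/
open scoped TensorProduct

/-- The image of an ideal of `R` in the total ring of fractions `Q(R)`,
as an `R`-submodule of `Q(R)`. -/
noncomputable def idealImage {R : Type*} [CommRing R] (I : Ideal R) :
    Submodule R (FractionRing R) :=
  Submodule.map (Algebra.linearMap R (FractionRing R)) I

/-- A nonzerodivisor acts injectively on a reflexive module. -/
theorem smul_left_cancel_of_isReflexive {R M : Type*} [CommRing R] [AddCommGroup M] [Module R M]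
    [Module.IsReflexive R M] {s : R} (hs : s ∈ nonZeroDivisors R) {x y : M}
    (h : s • x = s • y) : x = y := by
  apply (Module.bijective_dual_eval R M).injective
  ext f
  have hf : s * f x = s * f y := by simpa using congrArg f h
  exact (mul_cancel_left_mem_nonZeroDivisors hs).mp hf

/-- If `s * a = r` in an `R`-algebra, then `s • (a • m) = r • m` for every compatible action. -/
theorem smul_smul_of_algebraMap_mul_eq {R B M : Type*} [CommRing R] [Semiring B] [Algebra R B]
    [AddCommGroup M] [Module R M] [Module B M]
    (h : ∀ (r : R) (m : M), algebraMap R B r • m = r • m)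
    {a : B} {r s : R} (ha : algebraMap R B s * a = algebraMap R B r) (m : M) :
    s • (a • m) = r • m := by
  rw [← h s, ← mul_smul, ha, h]

/-- Let `R` be a commutative Noetherian ring, `M` a finitely generated reflexive `R`-module
of positive rank, and `A = tr_R(M) : tr_R(M) ⊆ Q(R)` (an `R`-subalgebra of `Q(R)`). Then
any two `A`-module structures on `M` whose restriction along `R → A` is the given
`R`-module structure coincide; that is, the `A`-module structure on `M` extending the
`R`-action is unique. -/
theorem module_structure_unique {R : Type} [CommRing R] [IsNoetherianRing R]
    (M : Type) [AddCommGroup M] [Module R M] [Module.Finite R M] [Module.IsReflexive R M]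
    [Module.Free (FractionRing R) (FractionRing R ⊗[R] M)]
    (hrank : 0 < Module.rank (FractionRing R) (FractionRing R ⊗[R] M))
    (A : Subalgebra R (FractionRing R))
    (hA : Subalgebra.toSubmodule A = idealImage (traceIdeal R M) / idealImage (traceIdeal R M))
    (inst₁ inst₂ : Module ↥A M)
    (h₁ : ∀ (r : R) (m : M), (letI := inst₁; (algebraMap R ↥A r) • m) = r • m)
    (h₂ : ∀ (r : R) (m : M), (letI := inst₂; (algebraMap R ↥A r) • m) = r • m) :
    inst₁ = inst₂ := by
  apply Module.ext' inst₁ inst₂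
  intro a m
  obtain ⟨⟨r, s⟩, hrs⟩ := IsLocalization.surj (nonZeroDivisors R) (a : FractionRing R)
  have ha : algebraMap R A s * a = algebraMap R A r := by
    apply Subtype.ext
    rw [mul_comm]
    exact hrs
  apply smul_left_cancel_of_isReflexive s.2
  exact (@smul_smul_of_algebraMap_mul_eq R A M _ _ _ _ _ inst₁ h₁ a r s ha m).trans
    (@smul_smul_of_algebraMap_mul_eq R A M _ _ _ _ _ inst₂ h₂ a r s ha m).symm
end

section
/- Let R be a one-dimensional Cohen-Macaulay semi-local ring. Then the following are equivalent: (a) R satisfies both: (i) for every integrally closed ideal I of R containing a nonzerodivisor there exists a ∈ I with I^{n+1} = a·I^n for some n ≥ 0, and (ii) whenever x, y, z ∈ R with x a nonzerodivisor and both y/x and z/x (elements of Q(R)) are integral over R, then yz/x ∈ R; (b) for every integrally closed ideal I of R containing a nonzerodivisor there exists a ∈ I with I^2 = aI. -/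
/-- `x` is integral over the ideal `I`: there are `n ≥ 1` and `a_i ∈ I^i` with
`x^n + a_1 x^{n-1} + ... + a_n = 0`. -/
def IsIntegralOverIdeal {R : Type*} [CommRing R] (I : Ideal R) (x : R) : Prop :=
  ∃ n : ℕ, 0 < n ∧ ∃ a : ℕ → R, (∀ i, 1 ≤ i → i ≤ n → a i ∈ I ^ i) ∧
    x ^ n + ∑ i ∈ Finset.Icc 1 n, a i * x ^ (n - i) = 0

/-- An ideal is integrally closed if it contains every element integral over it. -/
def IsIntegrallyClosedIdeal {R : Type*} [CommRing R] (I : Ideal R) : Prop :=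
  ∀ x : R, IsIntegralOverIdeal I x → x ∈ I

/-- A one-dimensional Cohen-Macaulay semi-local ring: a commutative Noetherian ring with
finitely many maximal ideals, all of whose localizations at maximal ideals are Noetherian
local rings of Krull dimension one whose maximal ideal contains a nonzerodivisor. -/
def IsOneDimCMSemiLocal (R : Type*) [CommRing R] : Prop :=
  IsNoetherianRing R ∧ {I : Ideal R | I.IsMaximal}.Finite ∧
  ∀ m : Ideal R, (hm : m.IsMaximal) →
    letI := hm.isPrime
    ringKrullDim (Localization.AtPrime m) = 1 ∧
    ∃ x ∈ IsLocalRing.maximalIdeal (Localization.AtPrime m),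
      x ∈ nonZeroDivisors (Localization.AtPrime m)

open Polynomial in
theorem isIntegral_of_integral_coeffs {R K : Type*} [CommRing R] [CommRing K] [Algebra R K]
    {w : K} {n : ℕ} {b : ℕ → K} (hb : ∀ i, 1 ≤ i → i ≤ n → IsIntegral R (b i))
    (h : w ^ n + ∑ i ∈ Finset.Icc 1 n, b i * w ^ (n - i) = 0) : IsIntegral R w := by
  classical
  let c : ℕ → integralClosure R K := fun i ↦
    if hi : 1 ≤ i ∧ i ≤ n then ⟨b i, hb i hi.1 hi.2⟩ else 0
  refine isIntegral_trans (A := integralClosure R K) w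
    ⟨X ^ n + ∑ i ∈ Finset.Icc 1 n, C (c i) * X ^ (n - i), monic_X_pow_add ?_, ?_⟩
  · refine (degree_sum_le _ _).trans_lt ((Finset.sup_lt_iff (WithBot.bot_lt_coe n)).2 ?_)
    intro i hi
    rw [Finset.mem_Icc] at hi
    refine (degree_C_mul_X_pow_le _ _).trans_lt ?_
    exact Nat.cast_lt.2 (by omega)
  · rw [← h, eval₂_add, eval₂_finsetSum]
    simp only [eval₂_mul, eval₂_C, eval₂_X_pow]
    congr 1
    refine Finset.sum_congr rfl fun i hi ↦ ?_
    rw [Finset.mem_Icc] at hi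
    simp [c, hi]

open Polynomial in
theorem IsIntegral.exists_equation {R K : Type*} [CommRing R] [CommRing K] [Algebra R K]
    {w : K} (hw : IsIntegral R w) : ∃ n : ℕ, 0 < n ∧ ∃ c : ℕ → R,
      w ^ n + ∑ i ∈ Finset.Icc 1 n, algebraMap R K (c i) * w ^ (n - i) = 0 := by
  obtain ⟨p, hp, hw⟩ := hw
  set m := p.natDegree with hm
  have h : w ^ m + ∑ i ∈ Finset.range m, algebraMap R K (p.coeff i) * w ^ i = 0 := by
    rw [hp.as_sum, eval₂_add, eval₂_finsetSum] at hw
    simpa only [eval₂_mul, eval₂_C, eval₂_X_pow] using hw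
  rcases Nat.eq_zero_or_pos m with h0 | h0
  · have : Subsingleton K := subsingleton_of_zero_eq_one (by simpa [h0] using h.symm)
    exact ⟨1, one_pos, 0, Subsingleton.elim _ _⟩
  · refine ⟨m, h0, fun i ↦ p.coeff (m - i), ?_⟩
    rw [← h]
    congr 1
    refine Finset.sum_nbij' (m - ·) (m - ·) ?_ ?_ ?_ ?_ ?_ <;> grind

theorem isIntegral_of_mul_mem {R K : Type*} [CommRing R] [CommRing K] [Algebra R K]
    (N : Submodule R K) (hN : N.FG) {u w : K} (hu : u ∈ N) (hu' : IsUnit u)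
    (hw : ∀ v ∈ N, w * v ∈ N) : IsIntegral R w := by
  have : Module.Finite R N := Module.Finite.iff_fg.2 hN
  let f : Module.End R N := (LinearMap.mulLeft R w).restrict hw
  obtain ⟨p, hp, hpf⟩ := LinearMap.exists_monic_and_aeval_eq_zero R f
  have key : ∀ q : Polynomial R, ∀ v : N,
      ((Polynomial.aeval f q v : N) : K) = Polynomial.aeval w q * v := by
    intro q
    induction q using Polynomial.induction_on' with
    | add p q hp hq => intro v; simp [hp, hq, add_mul]
    | monomial n r =>
      have hpow : ∀ v : N, (((f ^ n) v : N) : K) = w ^ n * v := by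
        induction n with
        | zero => simp
        | succ n ih =>
          intro v
          rw [pow_succ', Module.End.mul_apply]
          change w * _ = _
          rw [Submodule.subtype_apply, ih, pow_succ', mul_assoc]
      intro v
      simp [Polynomial.aeval_monomial, hpow, Module.algebraMap_end_apply, Algebra.smul_def, mul_assoc]
  refine ⟨p, hp, ?_⟩
  have h := key p ⟨u, hu⟩
  rw [hpf] at h
  exact (hu'.mul_left_eq_zero).1 h.symm

theorem mul_mem_of_isIntegral_of_mul_eq_one {R K : Type*} [CommRing R] [CommRing K] [Algebra R K]
    (J : Submodule R K) {t w : K} (hw : IsIntegral R w) (h1 : w * t = 1)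
    (ht : ∀ v ∈ J, t * v ∈ J) {v : K} (hv : v ∈ J) : w * v ∈ J := by
  obtain ⟨n, hn, c, h⟩ := hw.exists_equation
  have htp : ∀ k : ℕ, t ^ k * v ∈ J := by
    intro k
    induction k with
    | zero => simpa
    | succ k ih => rw [pow_succ', mul_assoc]; exact ht _ ih
  have hwt : ∀ k : ℕ, w ^ k * t ^ k = 1 := fun k ↦ by rw [← mul_pow, h1, one_pow]
  obtain ⟨m, rfl⟩ : ∃ m, n = m + 1 := ⟨n - 1, by omega⟩
  have h2 : w * v = -∑ i ∈ Finset.Icc 1 (m + 1), c i • (t ^ (i - 1) * v) := by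
    have h3 := congrArg (· * (t ^ m * v)) h
    simp only [add_mul, zero_mul, Finset.sum_mul] at h3
    have h4 : w ^ (m + 1) * (t ^ m * v) = w * v := by linear_combination w * v * hwt m
    rw [h4] at h3
    rw [eq_neg_iff_add_eq_zero, ← h3]
    congr 1
    refine Finset.sum_congr rfl fun i hi ↦ ?_
    obtain ⟨j, rfl⟩ : ∃ j, m = j + (i - 1) := ⟨m - (i - 1), by grind⟩
    have : j + (i - 1) + 1 - i = j := by grind
    rw [this, Algebra.smul_def]
    linear_combination (-algebraMap R K (c i) * t ^ (i - 1) * v) * hwt j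
  rw [h2]
  exact J.neg_mem (J.sum_mem fun i _ ↦ J.smul_mem _ (htp _))

/-- The ideal of all `r` such that `r * u` is integral over `R`. -/
def integralMulIdeal (R : Type*) {K : Type*} [CommRing R] [CommRing K] [Algebra R K] (u : K) :
    Ideal R where
  carrier := {r | IsIntegral R (algebraMap R K r * u)}
  add_mem' {r s} hr hs := by
    simp only [Set.mem_ofPred_eq, map_add, add_mul] at *
    exact hr.add hs
  zero_mem' := by simp [isIntegral_zero]
  smul_mem' r s hs := by
    simp only [Set.mem_ofPred_eq, smul_eq_mul, map_mul, mul_assoc] at *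
    exact isIntegral_algebraMap.mul hs

theorem mem_integralMulIdeal {R K : Type*} [CommRing R] [CommRing K] [Algebra R K] {u : K} {r : R} :
    r ∈ integralMulIdeal R u ↔ IsIntegral R (algebraMap R K r * u) := Iff.rfl

theorem isIntegral_of_mem_integralMulIdeal_pow {R K : Type*} [CommRing R] [CommRing K]
    [Algebra R K] {u : K} (n : ℕ) {r : R} (hr : r ∈ integralMulIdeal R u ^ n) :
    IsIntegral R (algebraMap R K r * u ^ n) := by
  rw [← mem_integralMulIdeal]
  suffices integralMulIdeal R u ^ n ≤ integralMulIdeal R (u ^ n) from this hr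
  clear hr
  induction n with
  | zero => exact fun r _ ↦ by simpa [mem_integralMulIdeal] using isIntegral_algebraMap
  | succ n ih =>
    rw [pow_succ, Ideal.mul_le]
    intro r hr s hs
    have := (mem_integralMulIdeal.1 (ih hr)).mul (mem_integralMulIdeal.1 hs)
    rw [mem_integralMulIdeal]
    convert this using 1
    rw [map_mul]; ring

theorem isIntegrallyClosedIdeal_integralMulIdeal {R K : Type*} [CommRing R] [CommRing K]
    [Algebra R K] (u : K) : IsIntegrallyClosedIdeal (integralMulIdeal R u) := by
  rintro s ⟨n, -, a, ha, h⟩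
  rw [mem_integralMulIdeal]
  refine isIntegral_of_integral_coeffs (n := n) (b := fun i ↦ algebraMap R K (a i) * u ^ i)
    (fun i h1 h2 ↦ isIntegral_of_mem_integralMulIdeal_pow i (ha i h1 h2)) ?_
  have h3 := congrArg (fun r ↦ algebraMap R K r * u ^ n) h
  simp only [map_add, map_sum, map_mul, map_pow, map_zero, zero_mul, add_mul, Finset.sum_mul] at h3
  rw [← h3, mul_pow]
  congr 1
  refine Finset.sum_congr rfl fun i hi ↦ ?_
  have hi := (Finset.mem_Icc.1 hi).2
  rw [mul_pow, ← pow_mul_pow_sub u hi]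
  ring

theorem isIntegralOverIdeal_of_eq_mul {R K : Type*} [CommRing R] [CommRing K] [Algebra R K]
    (hinj : Function.Injective (algebraMap R K)) {I : Ideal R} {a r : R} (ha : a ∈ I) {w : K}
    (hw : IsIntegral R w) (hr : algebraMap R K r = algebraMap R K a * w) :
    IsIntegralOverIdeal I r := by
  obtain ⟨n, hn, c, h⟩ := hw.exists_equation
  refine ⟨n, hn, fun i ↦ c i * a ^ i,
    fun i _ _ ↦ Ideal.mul_mem_left _ _ (Ideal.pow_mem_pow ha i), hinj ?_⟩
  have h3 := congrArg (algebraMap R K a ^ n * ·) h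
  simp only [mul_zero, mul_add, Finset.mul_sum] at h3
  simp only [map_add, map_sum, map_mul, map_pow, map_zero, hr]
  rw [← h3, mul_pow]
  congr 1
  refine Finset.sum_congr rfl fun i hi ↦ ?_
  have hi := (Finset.mem_Icc.1 hi).2
  rw [mul_pow, ← pow_mul_pow_sub (algebraMap R K a) hi]
  ring

theorem mem_nonZeroDivisors_of_pow_eq {R : Type*} [CommRing R] {I : Ideal R} {a x : R} {n : ℕ}
    (hx : x ∈ I) (hx' : x ∈ nonZeroDivisors R) (h : I ^ (n + 1) = Ideal.span {a} * I ^ n) :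
    a ∈ nonZeroDivisors R := by
  have h1 : x ^ (n + 1) ∈ Ideal.span {a} * I ^ n := h ▸ Ideal.pow_mem_pow hx _
  obtain ⟨b, -, hb⟩ := Ideal.mem_span_singleton_mul.1 h1
  have := pow_mem hx' (n + 1)
  rw [← hb] at this
  exact (mul_mem_nonZeroDivisors.1 this).1

theorem isIntegral_mk'_of_pow_eq {R : Type*} [CommRing R] [IsNoetherianRing R] {I : Ideal R}
    {a x y : R} {n : ℕ} (ha : a ∈ nonZeroDivisors R) (hx : x ∈ I) (hx' : x ∈ nonZeroDivisors R)
    (h : I ^ (n + 1) = Ideal.span {a} * I ^ n) (hy : y ∈ I) :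
    IsIntegral R
      (IsLocalization.mk' (FractionRing R) y (⟨a, ha⟩ : nonZeroDivisors R)) := by
  refine isIntegral_of_mul_mem (Submodule.map (Algebra.linearMap R (FractionRing R)) (I ^ n))
    ((IsNoetherian.noetherian _).map _) (u := algebraMap R _ (x ^ n))
    ⟨x ^ n, Ideal.pow_mem_pow hx n, rfl⟩
    (IsLocalization.map_units _ (⟨x ^ n, pow_mem hx' n⟩ : nonZeroDivisors R)) ?_
  rintro _ ⟨v, hv, rfl⟩
  have h1 : y * v ∈ Ideal.span {a} * I ^ n := h ▸ pow_succ' I n ▸ Ideal.mul_mem_mul hy hv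
  obtain ⟨b, hb, hb'⟩ := Ideal.mem_span_singleton_mul.1 h1
  refine ⟨b, hb, ?_⟩
  rw [Algebra.linearMap_apply, Algebra.linearMap_apply,
    ← (IsLocalization.map_units (FractionRing R) (⟨a, ha⟩ : nonZeroDivisors R)).mul_right_inj,
    ← mul_assoc, IsLocalization.mk'_spec'_mk, ← map_mul, ← map_mul, hb']

/-- Let `R` be a one-dimensional Cohen-Macaulay semi-local ring. Then the following are
equivalent: (a) `R` satisfies both: (i) for every integrally closed ideal `I` of `R`
containing a nonzerodivisor there exists `a ∈ I` with `I^{n+1} = a·I^n` for some `n ≥ 0`,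
and (ii) whenever `x, y, z ∈ R` with `x` a nonzerodivisor and both `y/x` and `z/x`
(elements of `Q(R)`) are integral over `R`, then `yz/x ∈ R`;
(b) for every integrally closed ideal `I` of `R` containing a nonzerodivisor there exists
`a ∈ I` with `I² = aI`. -/
theorem arf_characterization {R : Type} [CommRing R] (hR : IsOneDimCMSemiLocal R) :
    ((∀ I : Ideal R, IsIntegrallyClosedIdeal I → (∃ x ∈ I, x ∈ nonZeroDivisors R) →
        ∃ a ∈ I, ∃ n : ℕ, I ^ (n + 1) = Ideal.span {a} * I ^ n) ∧
      (∀ x y z : R, (hx : x ∈ nonZeroDivisors R) →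
        IsIntegral R (IsLocalization.mk' (FractionRing R) y (⟨x, hx⟩ : nonZeroDivisors R)) →
        IsIntegral R (IsLocalization.mk' (FractionRing R) z (⟨x, hx⟩ : nonZeroDivisors R)) →
        ∃ r : R, algebraMap R (FractionRing R) r =
          IsLocalization.mk' (FractionRing R) (y * z) (⟨x, hx⟩ : nonZeroDivisors R))) ↔
    (∀ I : Ideal R, IsIntegrallyClosedIdeal I → (∃ x ∈ I, x ∈ nonZeroDivisors R) →
      ∃ a ∈ I, I ^ 2 = Ideal.span {a} * I) := by
  have := hR.1
  have hinj := IsFractionRing.injective R (FractionRing R)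
  constructor
  · rintro ⟨h1, h2⟩ I hI ⟨x, hxI, hx⟩
    obtain ⟨a, haI, n, h⟩ := h1 I hI ⟨x, hxI, hx⟩
    have ha := mem_nonZeroDivisors_of_pow_eq hxI hx h
    refine ⟨a, haI, le_antisymm ?_ ?_⟩
    · rw [pow_two, Ideal.mul_le]
      intro y hy z hz
      have hy' := isIntegral_mk'_of_pow_eq ha hxI hx h hy
      have hz' := isIntegral_mk'_of_pow_eq ha hxI hx h hz
      obtain ⟨r, hr⟩ := h2 a y z ha hy' hz'
      have hr2 := IsLocalization.eq_mk'_iff_mul_eq.1 hr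
      refine Ideal.mem_span_singleton_mul.2 ⟨r, hI r ?_, hinj ?_⟩
      · refine isIntegralOverIdeal_of_eq_mul hinj haI (hy'.mul hz') ?_
        rw [hr, IsLocalization.mk'_eq_iff_eq_mul, map_mul]
        linear_combination (-algebraMap R (FractionRing R) z) *
          IsLocalization.mk'_spec'_mk (FractionRing R) y a ha -
          (algebraMap R (FractionRing R) a * IsLocalization.mk' (FractionRing R) y ⟨a, ha⟩) *
          IsLocalization.mk'_spec'_mk (FractionRing R) z a ha
      · rw [← hr2, map_mul, mul_comm]
    · rw [pow_two]
      exact Ideal.mul_mono_left ((Ideal.span_singleton_le_iff_mem I).2 haI)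
  · intro hb
    refine ⟨fun I hI hx ↦ ?_, fun x y z hx hy hz ↦ ?_⟩
    · obtain ⟨a, ha, h⟩ := hb I hI hx
      exact ⟨a, ha, 1, by simpa using h⟩
    · set K := FractionRing R
      set g := algebraMap R K
      obtain ⟨u, hu⟩ := (IsLocalization.map_units K
        (⟨x, hx⟩ : nonZeroDivisors R)).exists_right_inv
      change g x * u = 1 at hu
      have hmk : ∀ s : R, IsLocalization.mk' K s (⟨x, hx⟩ : nonZeroDivisors R) = g s * u := by
        intro s
        rw [IsLocalization.mk'_eq_iff_eq_mul]
        linear_combination (-g s) * hu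
      rw [hmk] at hy hz ⊢
      have hxI : x ∈ integralMulIdeal R u := by
        rw [mem_integralMulIdeal, hu]; exact isIntegral_one
      obtain ⟨a, haI, h⟩ := hb _ (isIntegrallyClosedIdeal_integralMulIdeal u) ⟨x, hxI, hx⟩
      have ha := mem_nonZeroDivisors_of_pow_eq (n := 1) hxI hx (by simpa using h)
      obtain ⟨b, hb⟩ := (IsLocalization.map_units K
        (⟨a, ha⟩ : nonZeroDivisors R)).exists_right_inv
      change g a * b = 1 at hb
      have hmul : ∀ s ∈ integralMulIdeal R u, ∀ t ∈ integralMulIdeal R u,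
          ∃ r ∈ integralMulIdeal R u, g a * g r = g s * g t := by
        intro s hs t ht
        have h1 : s * t ∈ Ideal.span {a} * integralMulIdeal R u :=
          h ▸ pow_two (integralMulIdeal R u) ▸ Ideal.mul_mem_mul hs ht
        obtain ⟨r, hr, hr'⟩ := Ideal.mem_span_singleton_mul.1 h1
        exact ⟨r, hr, by rw [← map_mul, hr', map_mul]⟩
      obtain ⟨i, hi, hi'⟩ := hmul y hy z hz
      obtain ⟨r, -, hr⟩ := mul_mem_of_isIntegral_of_mul_eq_one
        (Submodule.map (Algebra.linearMap R K) (integralMulIdeal R u)) (t := g x * b)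
        (w := g a * u) (mem_integralMulIdeal.1 haI)
        (by linear_combination g a * b * hu + hb) (v := g i)
        (by
          rintro _ ⟨v, hv, rfl⟩
          obtain ⟨r, hr, hr'⟩ := hmul x hxI v hv
          refine ⟨r, hr, ?_⟩
          change g r = g x * b * g v
          linear_combination b * hr' - g r * hb) ⟨i, hi, rfl⟩
      refine ⟨r, ?_⟩
      change g r = _ at hr
      rw [hr, map_mul]
      linear_combination u * hi'
end

section
/- Let R be a commutative Noetherian local ring and M a finitely generated R-module. Then tr_R(M) = R if and only if M has a nonzero free direct summand. -/
section TraceIdeal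

variable {R : Type*} [CommRing R] {M : Type*} [AddCommGroup M] [Module R M]

theorem traceIdeal_eq_top_of_apply_eq_one {f : M →ₗ[R] R} {x : M} (h : f x = 1) :
    traceIdeal R M = ⊤ :=
  (Ideal.eq_top_iff_one _).2 <|
    (le_iSup (fun g : M →ₗ[R] R => LinearMap.range g) f) ⟨x, h⟩

/-- Over a local ring, some functional takes the value `1` if the trace ideal is everything. -/
theorem exists_apply_eq_one_of_traceIdeal_eq_top [IsLocalRing R] (h : traceIdeal R M = ⊤) :
    ∃ (f : M →ₗ[R] R) (x : M), f x = 1 := by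
  by_contra! hne
  refine (IsLocalRing.maximalIdeal.isMaximal R).ne_top (top_le_iff.1 ?_)
  rw [← h]
  refine iSup_le fun f => IsLocalRing.le_maximalIdeal fun htop => ?_
  obtain ⟨x, hx⟩ := (Ideal.eq_top_iff_one _).1 htop
  exact hne f x hx

theorem isCompl_span_singleton_ker_of_apply_eq_one {f : M →ₗ[R] R} {x : M} (h : f x = 1) :
    IsCompl (R ∙ x) (LinearMap.ker f) := by
  constructor
  · rw [Submodule.disjoint_def]
    intro y hy hfy
    obtain ⟨r, rfl⟩ := Submodule.mem_span_singleton.1 hy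
    have hr : r = 0 := by simpa [h] using hfy
    rw [hr, zero_smul]
  · rw [codisjoint_iff, eq_top_iff]
    intro y _
    exact Submodule.mem_sup.2 ⟨f y • x, Submodule.mem_span_singleton.2 ⟨_, rfl⟩, y - f y • x,
      by simp [h], by abel⟩

theorem free_span_singleton_of_apply_eq_one {f : M →ₗ[R] R} {x : M} (h : f x = 1) :
    Module.Free R (R ∙ x) := by
  have hinj : Function.Injective (LinearMap.toSpanSingleton R M x) := fun a b hab => by
    simpa [h] using congrArg f hab
  rw [← LinearMap.range_toSpanSingleton]
  exact Module.Free.of_equiv (LinearEquiv.ofInjective _ hinj)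

theorem Module.Free.exists_apply_eq_one (F : Type*) [AddCommGroup F] [Module R F]
    [Module.Free R F] [Nontrivial F] : ∃ (f : F →ₗ[R] R) (x : F), f x = 1 := by
  let b := Module.Free.chooseBasis R F
  obtain ⟨i⟩ := b.index_nonempty
  exact ⟨b.coord i, b i, by simp⟩

end TraceIdeal

/-- Let `R` be a commutative Noetherian local ring and `M` a finitely generated
`R`-module. Then `tr_R(M) = R` if and only if `M` has a nonzero free direct summand. -/
theorem traceIdeal_eq_top_iff_free_summand {R : Type} [CommRing R] [IsNoetherianRing R]
    [IsLocalRing R] (M : Type) [AddCommGroup M] [Module R M] [Module.Finite R M] :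
    traceIdeal R M = ⊤ ↔
      ∃ F N : Submodule R M, IsCompl F N ∧ Module.Free R ↥F ∧ F ≠ ⊥ := by
  constructor
  · intro h
    obtain ⟨f, x, hx⟩ := exists_apply_eq_one_of_traceIdeal_eq_top h
    refine ⟨R ∙ x, LinearMap.ker f, isCompl_span_singleton_ker_of_apply_eq_one hx,
      free_span_singleton_of_apply_eq_one hx, fun hbot => ?_⟩
    rw [Submodule.span_singleton_eq_bot] at hbot
    simp [hbot] at hx
  · rintro ⟨F, N, hFN, hfree, hF⟩
    have : Nontrivial F := Submodule.nontrivial_iff_ne_bot.2 hF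
    obtain ⟨g, x, hx⟩ := Module.Free.exists_apply_eq_one (R := R) F
    refine traceIdeal_eq_top_of_apply_eq_one (f := g ∘ₗ Submodule.projectionOnto F N hFN) (x := (x : M)) ?_
    simp [hx]
end

section
/- Let R be a one-dimensional Cohen-Macaulay semi-local Arf ring and I a trace ideal of R containing a nonzerodivisor of R. Then I is integrally closed. -/
/-- A ring `R` is an Arf ring if for every integrally closed ideal `I` of `R` containing a
nonzerodivisor there exists `a ∈ I` with `I² = aI`. -/
def IsArfRing (R : Type*) [CommRing R] : Prop :=
  ∀ I : Ideal R, IsIntegrallyClosedIdeal I → (∃ x ∈ I, x ∈ nonZeroDivisors R) →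
    ∃ a ∈ I, I ^ 2 = Ideal.span {a} * I

open Polynomial in
theorem isIntegral_monomial_of_isIntegralOverIdeal {R : Type*} [CommRing R] {I : Ideal R} {x : R}
    (hx : IsIntegralOverIdeal I x) : IsIntegral (reesAlgebra I) (monomial 1 x) := by
  obtain ⟨n, hn, a, ha, h⟩ := hx
  have hc : ∀ i, ∃ c : reesAlgebra I, i ∈ Finset.Icc 1 n → (c : R[X]) = monomial i (a i) := by
    intro i
    by_cases hi : i ∈ Finset.Icc 1 n
    · rw [Finset.mem_Icc] at hi
      exact ⟨⟨monomial i (a i), reesAlgebra.monomial_mem.mpr (ha i hi.1 hi.2)⟩, fun _ => rfl⟩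
    · exact ⟨0, fun h => absurd h hi⟩
  choose c hc using hc
  refine ⟨X ^ n + ∑ i ∈ Finset.Icc 1 n, C (c i) * X ^ (n - i), monic_X_pow_add ?_, ?_⟩
  · rw [← mem_degreeLT]
    refine Submodule.sum_mem _ fun i hi => ?_
    rw [Finset.mem_Icc] at hi
    rw [mem_degreeLT]
    exact (degree_C_mul_X_pow_le _ _).trans_lt (by exact_mod_cast (by lia : n - i < n))
  · have key := congrArg (monomial n : R →ₗ[R] R[X]) h
    rw [map_add, map_sum, map_zero] at key
    rw [eval₂_add, eval₂_finsetSum, eval₂_X_pow, ← key]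
    congr 1
    · rw [monomial_pow, one_mul]
    · refine Finset.sum_congr rfl fun i hi => ?_
      rw [eval₂_mul, eval₂_C, eval₂_X_pow, monomial_pow, one_mul]
      change (c i : R[X]) * _ = _
      rw [hc i hi, monomial_mul_monomial]
      rw [Finset.mem_Icc] at hi
      rw [Nat.add_sub_cancel' hi.2]

open Polynomial in
theorem isIntegralOverIdeal_of_isIntegral_monomial {R : Type*} [CommRing R] {I : Ideal R} {x : R}
    (hx : IsIntegral (reesAlgebra I) (monomial 1 x)) : IsIntegralOverIdeal I x := by
  cases subsingleton_or_nontrivial R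
  · exact ⟨1, one_pos, 0, fun _ _ _ => Submodule.zero_mem _, Subsingleton.elim _ _⟩
  obtain ⟨p, hp, h⟩ := hx
  have hn : 0 < p.natDegree := by
    by_contra h0
    rw [hp.natDegree_eq_zero.mp (by lia), eval₂_one] at h
    exact one_ne_zero h
  refine ⟨p.natDegree, hn, fun i => (p.coeff (p.natDegree - i) : R[X]).coeff i,
    fun i _ _ => mem_reesAlgebra_iff I _ |>.mp (p.coeff _).2 i, ?_⟩
  have key := congrArg (fun q : R[X] => q.coeff p.natDegree) h
  simp only [eval₂_eq_sum_range, finsetSum_coeff, coeff_zero, monomial_pow, one_mul] at key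
  rw [Finset.sum_range_succ, hp.coeff_natDegree, map_one, one_mul, coeff_monomial_same,
    add_comm] at key
  rw [← key]
  congr 1
  refine Finset.sum_nbij' (p.natDegree - ·) (p.natDegree - ·) ?_ ?_ ?_ ?_ ?_
  · intro i hi; simp only [Finset.mem_Icc, Finset.mem_range] at *; lia
  · intro i hi; simp only [Finset.mem_Icc, Finset.mem_range] at *; lia
  · intro i hi; rw [Finset.mem_Icc] at hi; lia
  · intro i hi; rw [Finset.mem_range] at hi; lia
  · intro i hi
    rw [Finset.mem_Icc] at hi
    change _ = ((p.coeff (p.natDegree - i) : R[X]) * _).coeff _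
    rw [← C_mul_X_pow_eq_monomial, ← mul_assoc, coeff_mul_X_pow', if_pos (Nat.sub_le _ _),
      coeff_mul_C, Nat.sub_sub_self hi.2]

/-- The integral closure of an ideal. -/
def idealIntegralClosure {R : Type*} [CommRing R] (I : Ideal R) : Ideal R where
  carrier := {x | IsIntegral (reesAlgebra I) (Polynomial.monomial 1 x)}
  zero_mem' := by
    simpa using (isIntegral_zero : IsIntegral (reesAlgebra I) (0 : Polynomial R))
  add_mem' := by
    intro x y hx hy
    simpa using IsIntegral.add hx hy
  smul_mem' := by
    intro r x hx
    have := IsIntegral.smul r hx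
    simpa [Polynomial.smul_monomial] using this

theorem mem_idealIntegralClosure_iff {R : Type*} [CommRing R] {I : Ideal R} {x : R} :
    x ∈ idealIntegralClosure I ↔ IsIntegralOverIdeal I x :=
  ⟨isIntegralOverIdeal_of_isIntegral_monomial, isIntegral_monomial_of_isIntegralOverIdeal⟩

theorem le_idealIntegralClosure {R : Type*} [CommRing R] (I : Ideal R) :
    I ≤ idealIntegralClosure I := by
  intro x hx
  exact isIntegral_algebraMap (R := reesAlgebra I)
    (x := ⟨Polynomial.monomial 1 x, reesAlgebra.monomial_mem.mpr (by simpa using hx)⟩)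

theorem isIntegrallyClosedIdeal_idealIntegralClosure {R : Type*} [CommRing R] (I : Ideal R) :
    IsIntegrallyClosedIdeal (idealIntegralClosure I) := by
  intro x hx
  set S := integralClosure (reesAlgebra I) (Polynomial R)
  have hle : reesAlgebra (idealIntegralClosure I) ≤ S.restrictScalars R := by
    rw [← adjoin_monomial_eq_reesAlgebra, Algebra.adjoin_le_iff]
    rintro _ ⟨y, hy, rfl⟩
    exact hy
  obtain ⟨p, hp, h⟩ := isIntegral_monomial_of_isIntegralOverIdeal hx
  have hS : IsIntegral S (Polynomial.monomial 1 x) :=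
    ⟨p.map ((algebraMap (reesAlgebra (idealIntegralClosure I)) (Polynomial R)).codRestrict S
      fun y => hle y.2), hp.map _, by rw [Polynomial.eval₂_map]; exact h⟩
  exact isIntegral_trans _ hS

theorem map_mem_traceIdeal {R M : Type*} [CommRing R] [AddCommGroup M] [Module R M]
    (f : traceIdeal R M →ₗ[R] R) (x : traceIdeal R M) : f x ∈ traceIdeal R M := by
  obtain ⟨x, hx⟩ := x
  have hle (g : M →ₗ[R] R) : LinearMap.range g ≤ traceIdeal R M := le_iSup _ g
  refine Submodule.iSup_induction' _
    (motive := fun y hy => f ⟨y, hy⟩ ∈ traceIdeal R M) ?_ ?_ ?_ hx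
  · rintro g _ ⟨m, rfl⟩
    exact hle (f ∘ₗ g.codRestrict _ fun m => hle g ⟨m, rfl⟩) ⟨m, rfl⟩
  · exact (map_zero f).symm ▸ Submodule.zero_mem _
  · intro y z hy hz hfy hfz
    have := Submodule.add_mem _ hfy hfz
    rwa [← map_add] at this

theorem exists_mul_eq_mul_of_forall_map_mem {R : Type*} [CommRing R] {I : Ideal R}
    (hI : ∀ (f : I →ₗ[R] R) (x : I), f x ∈ I) {a b : R} (ha : a ∈ nonZeroDivisors R)
    (hdvd : ∀ x ∈ I, a ∣ b * x) {x : R} (hx : x ∈ I) : ∃ y ∈ I, b * x = a * y := by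
  choose q hq using hdvd
  let f : I →ₗ[R] R :=
    { toFun := fun x => q x x.2
      map_add' := fun y z => by
        apply (mul_cancel_left_mem_nonZeroDivisors ha).mp
        rw [← hq, mul_add, ← hq, ← hq, Submodule.coe_add, mul_add]
      map_smul' := fun r y => by
        apply (mul_cancel_left_mem_nonZeroDivisors ha).mp
        rw [← hq, RingHom.id_apply, smul_eq_mul, mul_left_comm, ← hq, Submodule.coe_smul,
          smul_eq_mul, mul_left_comm] }
  exact ⟨f ⟨x, hx⟩, hI f _, hq x hx⟩

theorem pow_succ_le_span_pow_mul {R : Type*} [CommRing R] {I : Ideal R} {a : R}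
    (h : I * I ≤ Ideal.span {a} * I) (n : ℕ) : I ^ (n + 1) ≤ Ideal.span {a ^ n} * I := by
  induction n with
  | zero => simp
  | succ n ih =>
    calc I ^ (n + 1 + 1) = I ^ (n + 1) * I := pow_succ _ _
      _ ≤ Ideal.span {a ^ n} * I * I := Ideal.mul_mono_left ih
      _ ≤ Ideal.span {a ^ n} * (Ideal.span {a} * I) := by
        rw [mul_assoc]; exact Ideal.mul_mono_right h
      _ = Ideal.span {a ^ (n + 1)} * I := by
        rw [← mul_assoc, Ideal.span_singleton_mul_span_singleton, pow_succ]

theorem IsIntegralOverIdeal.mem_of_mul_self_le {R : Type*} [CommRing R] {I : Ideal R} {a : R}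
    (hint : IsIntegralOverIdeal I a) (ha : a ∈ nonZeroDivisors R)
    (h : I * I ≤ Ideal.span {a} * I) : a ∈ I := by
  obtain ⟨n, hn, c, hc, heq⟩ := hint
  obtain ⟨n, rfl⟩ := Nat.exists_eq_add_of_le' hn
  have hmem : a ^ (n + 1) ∈ Ideal.span {a ^ n} * I := by
    rw [eq_neg_of_add_eq_zero_left heq]
    refine neg_mem (Submodule.sum_mem _ fun i hi => ?_)
    rw [Finset.mem_Icc] at hi
    obtain ⟨i, rfl⟩ := Nat.exists_eq_add_of_le' hi.1
    obtain ⟨y, hy, hyc⟩ := Ideal.mem_span_singleton_mul.mp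
      (pow_succ_le_span_pow_mul h i (hc _ hi.1 hi.2))
    refine Ideal.mem_span_singleton_mul.mpr ⟨y, hy, ?_⟩
    rw [← hyc, mul_right_comm, ← pow_add]
    congr 2
    lia
  obtain ⟨y, hy, hya⟩ := Ideal.mem_span_singleton_mul.mp hmem
  rw [pow_succ] at hya
  rwa [← (mul_cancel_left_mem_nonZeroDivisors (pow_mem ha n)).mp hya]

/-- Let `R` be a one-dimensional Cohen-Macaulay semi-local Arf ring and `I` a trace ideal
of `R` containing a nonzerodivisor of `R`. Then `I` is integrally closed. -/
theorem trace_ideal_is_integrally_closed {R : Type} [CommRing R]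
    (hR : IsOneDimCMSemiLocal R) (hArf : IsArfRing R) (I : Ideal R)
    (htr : ∃ (M : Type) (_ : AddCommGroup M) (_ : Module R M),
      Module.Finite R M ∧ I = traceIdeal R M)
    (hnzd : ∃ x ∈ I, x ∈ nonZeroDivisors R) :
    IsIntegrallyClosedIdeal I := by
  have hI : ∀ (f : I →ₗ[R] R) (x : I), f x ∈ I := by
    obtain ⟨M, _, _, -, rfl⟩ := htr
    exact map_mem_traceIdeal
  obtain ⟨s, hsI, hs⟩ := hnzd
  set J := idealIntegralClosure I
  have hIJ : I ≤ J := le_idealIntegralClosure I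
  obtain ⟨a, haJ, hJ⟩ := hArf J (isIntegrallyClosedIdeal_idealIntegralClosure I) ⟨s, hIJ hsI, hs⟩
  have hdvd : ∀ b ∈ J, ∀ x ∈ J, a ∣ b * x := by
    intro b hb x hx
    have : b * x ∈ Ideal.span {a} * J := by
      rw [← hJ, pow_two]
      exact Ideal.mul_mem_mul hb hx
    obtain ⟨y, -, hy⟩ := Ideal.mem_span_singleton_mul.mp this
    exact ⟨y, hy.symm⟩
  have ha : a ∈ nonZeroDivisors R := by
    obtain ⟨q, hq⟩ := hdvd s (hIJ hsI) s (hIJ hsI)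
    have hss := mul_mem hs hs
    rw [hq] at hss
    exact (mul_mem_nonZeroDivisors.mp hss).1
  have hJI : ∀ b ∈ J, ∀ x ∈ I, ∃ y ∈ I, b * x = a * y := fun b hb x hx =>
    exists_mul_eq_mul_of_forall_map_mem hI ha (fun x hx => hdvd b hb x (hIJ hx)) hx
  have haI : a ∈ I := by
    refine (mem_idealIntegralClosure_iff.mp haJ).mem_of_mul_self_le ha ?_
    refine Ideal.mul_le.mpr fun b hb x hx => ?_
    obtain ⟨y, hy, h⟩ := hJI b (hIJ hb) x hx
    exact Ideal.mem_span_singleton_mul.mpr ⟨y, hy, h.symm⟩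
  intro x hx
  obtain ⟨y, hy, h⟩ := hJI x (mem_idealIntegralClosure_iff.mpr hx) a haI
  rw [mul_comm] at h
  rwa [(mul_cancel_left_mem_nonZeroDivisors ha).mp h]
end
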